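/- Let (X_m)_{m∈ℕ} be a sequence of real Banach spaces each having property KM_w. Then the ℓ₁-sum (⊕_{m∈ℕ} X_m)_{ℓ₁}, i.e., the Banach space of all sequences (x_m) with x_m ∈ X_m and ∑_m ‖x_m‖ < ∞ equipped with the norm ‖(x_m)‖ = ∑_m ‖x_m‖, has property KM_w. -/

import Mathlib

open Filter Topology

/-- `δ((x_n)) ≤ ε`: for every functional in the closed unit ball of the dual,
`limsup x*(x_n) − liminf x*(x_n) ≤ ε`. -/
def DeltaLE {E : Type*} [NormedAddCommGroup E] [NormedSpace ℝ E] (x : ℕ → E) (ε : ℝ) : Prop :=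
  ∀ f : E →L[ℝ] ℝ, ‖f‖ ≤ 1 →
    Filter.limsup (fun n => f (x n)) Filter.atTop
      - Filter.liminf (fun n => f (x n)) Filter.atTop ≤ ε

/-- A set `M` is `ε`-weakly precompact if it is bounded and every sequence in `M`
admits a subsequence `(x_{n_k})` with `δ((x_{n_k})) ≤ ε`. -/
def IsWeaklyPrecompactWith {E : Type*} [NormedAddCommGroup E] [NormedSpace ℝ E]
    (ε : ℝ) (M : Set E) : Prop :=
  Bornology.IsBounded M ∧
    ∀ x : ℕ → E, (∀ n, x n ∈ M) →
      ∃ φ : ℕ → ℕ, StrictMono φ ∧ DeltaLE (fun k => x (φ k)) ε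

/-- Property `KM_w`. -/
def HasKMw (X : Type*) [NormedAddCommGroup X] [NormedSpace ℝ X] : Prop :=
  ∃ M : ℕ → ℕ → Set X,
    (∀ n p : ℕ, 0 < p → IsWeaklyPrecompactWith (1 / (p : ℝ)) (M n p)) ∧
    (∀ C : Set X, IsWeaklyPrecompactWith 0 C → ∀ p : ℕ, 0 < p → ∃ n : ℕ, C ⊆ M n p)

/-- Eventual oscillation of all functionals in the dual ball is at most `ε`. -/
def Osc {E : Type*} [NormedAddCommGroup E] [NormedSpace ℝ E] (x : ℕ → E) (ε : ℝ) : Prop :=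
  ∀ f : E →L[ℝ] ℝ, ‖f‖ ≤ 1 → ∀ η, ε < η → ∃ n0, ∀ i j, n0 ≤ i → n0 ≤ j →
    f (x i) - f (x j) ≤ η

theorem abs_dual_le {E : Type*} [NormedAddCommGroup E] [NormedSpace ℝ E]
    (f : E →L[ℝ] ℝ) (hf : ‖f‖ ≤ 1) (x : E) : |f x| ≤ ‖x‖ := by
  have := f.le_of_opNorm_le hf x
  simpa using this

theorem osc_iff {E : Type*} [NormedAddCommGroup E] [NormedSpace ℝ E] (x : ℕ → E) (ε : ℝ)
    (B : ℝ) (hB : ∀ n, ‖x n‖ ≤ B) : DeltaLE x ε ↔ Osc x ε := by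
  unfold DeltaLE Osc
  refine forall_congr' fun f => forall_congr' fun hf => ?_
  have hu : ∀ n, |f (x n)| ≤ B := fun n => (abs_dual_le f hf _).trans (hB n)
  have h1 : atTop.IsBoundedUnder (· ≤ ·) (fun n => f (x n)) :=
    isBoundedUnder_of ⟨B, fun n => (abs_le.1 (hu n)).2⟩
  have h2 : atTop.IsBoundedUnder (· ≥ ·) (fun n => f (x n)) :=
    isBoundedUnder_of ⟨-B, fun n => (abs_le.1 (hu n)).1⟩
  constructor
  · intro h η hη
    have e1 := eventually_lt_of_limsup_lt (f := atTop) (u := fun n => f (x n))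
      (b := limsup (fun n => f (x n)) atTop + (η - ε) / 2) (by linarith) h1
    have e2 := eventually_lt_of_lt_liminf (f := atTop) (u := fun n => f (x n))
      (b := liminf (fun n => f (x n)) atTop - (η - ε) / 2) (by linarith) h2
    obtain ⟨n0, hn0⟩ := eventually_atTop.1 (e1.and e2)
    refine ⟨n0, fun i j hi hj => ?_⟩
    have := (hn0 i hi).1
    have := (hn0 j hj).2
    linarith
  · intro h
    refine le_of_forall_gt_imp_ge_of_dense fun η hη => ?_
    obtain ⟨n0, hn0⟩ := h η hη
    have key : ∀ j, n0 ≤ j → limsup (fun n => f (x n)) atTop ≤ f (x j) + η := fun j hj =>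
      limsup_le_of_le h2.isCoboundedUnder_le (eventually_atTop.2 ⟨n0, fun i hi => by
        have := hn0 i j hi hj
        linarith⟩)
    have : limsup (fun n => f (x n)) atTop - η ≤ liminf (fun n => f (x n)) atTop :=
      le_liminf_of_le h1.isCoboundedUnder_ge (eventually_atTop.2 ⟨n0, fun j hj => by
        have := key j hj
        linarith⟩)
    linarith

theorem wpc_iff {E : Type*} [NormedAddCommGroup E] [NormedSpace ℝ E] (ε : ℝ) (M : Set E) :
    IsWeaklyPrecompactWith ε M ↔ (∃ B, ∀ x ∈ M, ‖x‖ ≤ B) ∧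
      ∀ x : ℕ → E, (∀ n, x n ∈ M) → ∃ φ : ℕ → ℕ, StrictMono φ ∧ Osc (fun k => x (φ k)) ε := by
  unfold IsWeaklyPrecompactWith
  rw [isBounded_iff_forall_norm_le]
  refine and_congr_right fun ⟨B, hB⟩ => forall_congr' fun x => forall_congr' fun hx =>
    exists_congr fun φ => and_congr_right fun _ => osc_iff _ _ B fun n => hB _ (hx _)

theorem Osc.comp {E : Type*} [NormedAddCommGroup E] [NormedSpace ℝ E] {x : ℕ → E} {ε : ℝ}
    (h : Osc x ε) {φ : ℕ → ℕ} (hφ : StrictMono φ) : Osc (fun k => x (φ k)) ε := by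
  intro f hf η hη
  obtain ⟨n0, hn0⟩ := h f hf η hη
  exact ⟨n0, fun i j hi hj => hn0 _ _ (hi.trans (hφ.id_le i)) (hj.trans (hφ.id_le j))⟩

section
variable {X : ℕ → Type*} [∀ m, NormedAddCommGroup (X m)] [∀ m, NormedSpace ℝ (X m)]

/-- Coordinate projection. -/
noncomputable def prj (m : ℕ) : lp X 1 →L[ℝ] X m :=
  LinearMap.mkContinuous
    { toFun := fun x => x m
      map_add' := fun _ _ => rfl
      map_smul' := fun _ _ => rfl } 1 (fun x => by
        rw [one_mul]; exact lp.norm_apply_le_norm one_ne_zero x m)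

theorem prj_apply (m : ℕ) (x : lp X 1) : prj m x = x m := rfl

theorem norm_prj_le (m : ℕ) : ‖(prj m : lp X 1 →L[ℝ] X m)‖ ≤ 1 :=
  LinearMap.mkContinuous_norm_le _ zero_le_one _

/-- Coordinate inclusion. -/
noncomputable def inj (m : ℕ) : X m →L[ℝ] lp X 1 :=
  LinearMap.mkContinuous (lp.lsingle (𝕜 := ℝ) 1 m) 1 (fun x => by
    rw [one_mul]; exact (lp.norm_single (p := 1) (by simp) m x).le)

theorem inj_apply (m : ℕ) (x : X m) : inj m x = lp.single 1 m x := rfl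

theorem norm_inj_le (m : ℕ) : ‖(inj m : X m →L[ℝ] lp X 1)‖ ≤ 1 :=
  LinearMap.mkContinuous_norm_le _ zero_le_one _

theorem hasSum_norm_one (x : lp X 1) : HasSum (fun m => ‖x m‖) ‖x‖ := by
  simpa using lp.hasSum_norm (p := 1) (by simp) x

/-- Part of `x` outside the finite set `s`. -/
noncomputable def tl (s : Finset ℕ) (x : lp X 1) : lp X 1 :=
  x - ∑ i ∈ s, inj i (x i)

theorem norm_tl (s : Finset ℕ) (x : lp X 1) : ‖tl s x‖ = ‖x‖ - ∑ i ∈ s, ‖x i‖ := by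
  simpa [tl, inj_apply] using lp.norm_compl_sum_single (p := 1) (by simp) x s

theorem norm_tl_anti {s t : Finset ℕ} (h : s ⊆ t) (x : lp X 1) : ‖tl t x‖ ≤ ‖tl s x‖ := by
  rw [norm_tl, norm_tl]
  have := Finset.sum_le_sum_of_subset_of_nonneg h (f := fun i => ‖x i‖)
    (fun _ _ _ => norm_nonneg _)
  linarith

theorem tl_sub (s : Finset ℕ) (x y : lp X 1) : tl s (x - y) = tl s x - tl s y := by
  simp only [tl, lp.coeFn_sub, Pi.sub_apply, map_sub, Finset.sum_sub_distrib]
  abel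

theorem exists_tl_small (x : lp X 1) {ε : ℝ} (hε : 0 < ε) : ∃ s, ∀ t, s ⊆ t → ‖tl t x‖ < ε := by
  have h := hasSum_norm_one x
  rw [HasSum, SummationFilter.unconditional_filter, Metric.tendsto_atTop] at h
  obtain ⟨s, hs⟩ := h ε hε
  refine ⟨s, fun t ht => ?_⟩
  have := hs t ht
  rw [Real.dist_eq, abs_lt] at this
  rw [norm_tl]
  linarith [this.1]

/-- The product of the dual balls. -/
abbrev KK (X : ℕ → Type*) [∀ m, NormedAddCommGroup (X m)] [∀ m, NormedSpace ℝ (X m)] :=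
  ∀ m, Metric.closedBall (0 : X m →L[ℝ] ℝ) 1

theorem KK_le (g : KK X) (m : ℕ) (v : X m) : ‖(g m).1 v‖ ≤ ‖v‖ := by
  have := abs_dual_le (g m).1 (mem_closedBall_zero_iff.1 (g m).2) v
  simpa using this

theorem KK_summable (g : KK X) (y : lp X 1) : Summable fun m => (g m).1 (y m) :=
  Summable.of_norm_bounded (hasSum_norm_one y).summable fun m => KK_le g m _

/-- The functional on the `ℓ₁`-sum defined by an element of the product of dual balls. -/
noncomputable def fn (g : KK X) : lp X 1 →L[ℝ] ℝ :=
  LinearMap.mkContinuous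
    { toFun := fun y => ∑' m, (g m).1 (y m)
      map_add' := fun x y => by
        simp only [lp.coeFn_add, Pi.add_apply, map_add]
        exact (KK_summable g x).tsum_add (KK_summable g y)
      map_smul' := fun c x => by
        simp only [lp.coeFn_smul, Pi.smul_apply, map_smul, smul_eq_mul, RingHom.id_apply]
        exact tsum_mul_left } 1 (fun y => by
        rw [one_mul]
        exact tsum_of_norm_bounded (hasSum_norm_one y) fun m => KK_le g m _)

theorem fn_apply (g : KK X) (y : lp X 1) : fn g y = ∑' m, (g m).1 (y m) := rfl

theorem norm_fn_le (g : KK X) : ‖fn g‖ ≤ 1 :=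
  LinearMap.mkContinuous_norm_le _ zero_le_one _

theorem continuous_fn (y : lp X 1) : Continuous fun g : KK X => fn g y := by
  simp only [fn_apply]
  refine continuous_tsum (fun m => ?_) (hasSum_norm_one y).summable (fun m g => KK_le g m _)
  have h1 : Continuous fun g : KK X => (g m).1 := continuous_subtype_val.comp (continuous_apply m)
  exact h1.clm_apply continuous_const

theorem baire_step (y : ℕ → lp X 1) (hy : Osc y 0) {η : ℝ} (hη : 0 < η) :
    ∃ (s : Finset ℕ) (n : ℕ), ∀ i, n ≤ i → ‖tl s (y i - y n)‖ ≤ η := by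
  classical
  let F : ℕ → Set (KK X) := fun n => {g | ∀ i j, n ≤ i → n ≤ j → fn g (y i) - fn g (y j) ≤ η}
  have hc : ∀ n, IsClosed (F n) := by
    intro n
    have : F n = ⋂ i, ⋂ j, ⋂ (_ : n ≤ i), ⋂ (_ : n ≤ j), {g | fn g (y i) - fn g (y j) ≤ η} := by
      ext g
      simp [F]
    rw [this]
    exact isClosed_iInter fun i => isClosed_iInter fun j => isClosed_iInter fun _ =>
      isClosed_iInter fun _ =>
        isClosed_le ((continuous_fn (y i)).sub (continuous_fn (y j))) continuous_const
  have hU : ⋃ n, F n = Set.univ := by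
    refine Set.eq_univ_of_forall fun g => Set.mem_iUnion.2 ?_
    exact hy (fn g) (norm_fn_le g) η hη
  have : ∀ m, CompleteSpace (Metric.closedBall (0 : X m →L[ℝ] ℝ) 1) := fun m =>
    Metric.isClosed_closedBall.completeSpace_coe
  have : ∀ m, Nonempty (Metric.closedBall (0 : X m →L[ℝ] ℝ) 1) := fun m => ⟨⟨0, by simp⟩⟩
  have : Nonempty (KK X) := inferInstance
  have hcm : ∀ m, TopologicalSpace.IsCompletelyPseudoMetrizableSpace
      (Metric.closedBall (0 : X m →L[ℝ] ℝ) 1) := fun m =>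
    PseudoMetricSpace.toIsCompletelPseudoMetrizableSpace
  have hcK : TopologicalSpace.IsCompletelyPseudoMetrizableSpace (KK X) :=
    TopologicalSpace.IsCompletelyPseudoMetrizableSpace.pi_countable
  have : BaireSpace (KK X) := @BaireSpace.of_completelyPseudoMetrizable _ _ hcK
  obtain ⟨n, g, hg⟩ := nonempty_interior_of_iUnion_of_closed hc hU
  obtain ⟨s, u, hu, hsub⟩ := isOpen_pi_iff.1 isOpen_interior g hg
  refine ⟨s, n, fun i hi => ?_⟩
  set r := y i - y n with hr
  choose d hd hdr using fun m => exists_dual_vector'' ℝ (r m)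
  have hmem : ∀ g' : KK X, (∀ m ∈ s, g' m = g m) → |fn g' r| ≤ η := by
    intro g' h'
    have : g' ∈ F n := interior_subset (hsub fun m hm => by
      rw [h' m hm]; exact (hu m hm).2)
    have a := this i n hi le_rfl
    have b := this n i le_rfl hi
    rw [hr, map_sub, abs_le]
    constructor <;> linarith
  let gp : KK X := fun m => if m ∈ s then g m else ⟨d m, by simpa using hd m⟩
  let gm : KK X := fun m => if m ∈ s then g m else ⟨-d m, by simpa using hd m⟩
  have hp := hmem gp (fun m hm => by simp [gp, hm])
  have hm := hmem gm (fun m hm => by simp [gm, hm])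
  have hdiff : fn gp r - fn gm r = 2 * ‖tl s r‖ := by
    rw [fn_apply, fn_apply, ← (KK_summable gp r).tsum_sub (KK_summable gm r), norm_tl]
    have h1 : HasSum (fun m => if m ∈ s then ‖r m‖ else 0) (∑ m ∈ s, ‖r m‖) := by
      have := hasSum_sum_of_ne_finset_zero (L := .unconditional ℕ)
        (f := fun m => if m ∈ s then ‖r m‖ else 0) (s := s)
        (fun m hm => by simp [hm])
      convert this using 1
      exact Finset.sum_congr rfl fun m hm => by simp [hm]
    have h2 := ((hasSum_norm_one r).sub h1).mul_left 2
    rw [← h2.tsum_eq]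
    congr 1
    ext m
    by_cases hms : m ∈ s
    · simp [gp, gm, hms]
    · have := hdr m
      simp only [RCLike.ofReal_real_eq_id, id] at this
      simp [gp, gm, hms, this]
      ring
  rw [abs_le] at hp hm
  linarith [hp.2, hm.1]

theorem tails_small (C : Set (lp X 1)) (hC : IsWeaklyPrecompactWith 0 C) {ε : ℝ} (hε : 0 < ε) :
    ∃ s : Finset ℕ, ∀ x ∈ C, ‖tl s x‖ ≤ ε := by
  by_contra! hcon
  choose x hxC hx using fun k => hcon (Finset.range k)
  obtain ⟨φ, hφ, hosc⟩ := ((wpc_iff _ _).1 hC).2 x hxC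
  obtain ⟨s, n, hs⟩ := baire_step _ hosc (half_pos hε)
  obtain ⟨t, ht⟩ := exists_tl_small (x (φ n)) (half_pos hε)
  obtain ⟨N, hN⟩ := Finset.exists_nat_subset_range (s ∪ t)
  have hle : N ≤ φ (max n N) := (le_max_right n N).trans (hφ.id_le _)
  have h0 := hx (φ (max n N))
  have h1 := norm_tl_anti (Finset.range_subset_range.2 hle) (x (φ (max n N)))
  have h2 := norm_tl_anti (Finset.union_subset_left hN) (x (φ (max n N)) - x (φ n))
  have h3 := hs (max n N) (le_max_left _ _)
  have h4 := ht _ (Finset.union_subset_right hN)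
  have h5 := norm_sub_norm_le (tl (Finset.range N) (x (φ (max n N))))
    (tl (Finset.range N) (x (φ n)))
  rw [← tl_sub] at h5
  linarith

theorem proj_wpc (C : Set (lp X 1)) (hC : IsWeaklyPrecompactWith 0 C) (m : ℕ) :
    IsWeaklyPrecompactWith 0 ((fun x : lp X 1 => x m) '' C) := by
  rw [wpc_iff] at hC ⊢
  obtain ⟨⟨B, hB⟩, hC⟩ := hC
  refine ⟨⟨B, ?_⟩, fun x hx => ?_⟩
  · rintro _ ⟨x, hx, rfl⟩
    exact (lp.norm_apply_le_norm one_ne_zero x m).trans (hB x hx)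
  · choose z hz hzx using hx
    obtain ⟨φ, hφ, h⟩ := hC z hz
    refine ⟨φ, hφ, fun f hf η hη => ?_⟩
    obtain ⟨n0, hn0⟩ := h (f.comp (prj m)) ((f.opNorm_comp_le _).trans
      (mul_le_one₀ hf (norm_nonneg _) (norm_prj_le m))) η hη
    refine ⟨n0, fun i j hi hj => ?_⟩
    have := hn0 i j hi hj
    simp only [ContinuousLinearMap.comp_apply, prj_apply] at this
    simpa only [← hzx] using this

theorem finite_subseq (A : ∀ m, Set (X m)) (ε : ℝ) (hA : ∀ m, IsWeaklyPrecompactWith ε (A m))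
    (x : ℕ → lp X 1) (s : Finset ℕ) (hx : ∀ n, ∀ m ∈ s, x n m ∈ A m) :
    ∃ φ : ℕ → ℕ, StrictMono φ ∧ ∀ m ∈ s, Osc (fun k => x (φ k) m) ε := by
  classical
  induction s using Finset.induction_on with
  | empty => exact ⟨id, strictMono_id, by simp⟩
  | insert a s ha ih =>
    obtain ⟨φ, hφ, h⟩ := ih fun n m hm => hx n m (Finset.mem_insert_of_mem hm)
    obtain ⟨ψ, hψ, h'⟩ := ((wpc_iff _ _).1 (hA a)).2 (fun k => x (φ k) a)
      (fun n => hx _ a (Finset.mem_insert_self _ _))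
    refine ⟨φ ∘ ψ, hφ.comp hψ, fun m hm => ?_⟩
    rcases Finset.mem_insert.1 hm with rfl | hm
    · exact h'
    · exact (h m hm).comp hψ

theorem wpc_of_parts (A : ∀ m, Set (X m)) (s : Finset ℕ) (ε δ : ℝ)
    (hA : ∀ m, IsWeaklyPrecompactWith ε (A m)) :
    IsWeaklyPrecompactWith (s.card * ε + 2 * δ)
      {x : lp X 1 | (∀ m ∈ s, x m ∈ A m) ∧ ‖tl s x‖ ≤ δ} := by
  rw [wpc_iff]
  constructor
  · choose B hB using fun m => ((wpc_iff _ _).1 (hA m)).1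
    refine ⟨δ + ∑ m ∈ s, B m, fun x hx => ?_⟩
    have h1 := hx.2
    rw [norm_tl] at h1
    have := Finset.sum_le_sum fun m hm => hB m _ (hx.1 m hm)
    linarith
  · intro x hx
    obtain ⟨φ, hφ, h⟩ := finite_subseq A ε hA x s fun n => (hx n).1
    refine ⟨φ, hφ, fun f hf η hη => ?_⟩
    set κ := (η - (s.card * ε + 2 * δ)) / (s.card + 1) with hκ
    have hκ0 : 0 < κ := div_pos (by linarith) (by positivity)
    have hκ1 : κ * (s.card + 1) = η - (s.card * ε + 2 * δ) := by
      rw [hκ]; field_simp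
    have hex : ∀ m, ∃ n0, m ∈ s → ∀ i j, n0 ≤ i → n0 ≤ j →
        f (inj m (x (φ i) m)) - f (inj m (x (φ j) m)) ≤ ε + κ := by
      intro m
      by_cases hm : m ∈ s
      · obtain ⟨n0, hn0⟩ := h m hm (f.comp (inj m)) ((f.opNorm_comp_le _).trans
          (mul_le_one₀ hf (norm_nonneg _) (norm_inj_le m))) (ε + κ) (by linarith)
        exact ⟨n0, fun _ => hn0⟩
      · exact ⟨0, fun h => absurd h hm⟩
    choose n0 hn0 using hex
    refine ⟨s.sup n0, fun i j hi hj => ?_⟩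
    have dec : ∀ z : lp X 1, f z = f (tl s z) + ∑ m ∈ s, f (inj m (z m)) := by
      intro z
      rw [tl, map_sub, map_sum]
      ring
    have hsum : ∑ m ∈ s, (f (inj m (x (φ i) m)) - f (inj m (x (φ j) m)))
        ≤ ∑ m ∈ s, (ε + κ) := Finset.sum_le_sum fun m hm =>
      hn0 m hm i j ((Finset.le_sup hm).trans hi) ((Finset.le_sup hm).trans hj)
    rw [Finset.sum_sub_distrib, Finset.sum_const, nsmul_eq_mul] at hsum
    have t1 := abs_le.1 ((abs_dual_le f hf (tl s (x (φ i)))).trans (hx _).2)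
    have t2 := abs_le.1 ((abs_dual_le f hf (tl s (x (φ j)))).trans (hx _).2)
    rw [dec (x (φ i)), dec (x (φ j))]
    nlinarith [t1.2, t2.1]

theorem wpc_mono {E : Type*} [NormedAddCommGroup E] [NormedSpace ℝ E] {ε ε' : ℝ} (h : ε ≤ ε')
    {M : Set E} (hM : IsWeaklyPrecompactWith ε M) : IsWeaklyPrecompactWith ε' M :=
  ⟨hM.1, fun x hx => by
    obtain ⟨φ, hφ, hd⟩ := hM.2 x hx
    exact ⟨φ, hφ, fun f hf => (hd f hf).trans h⟩⟩

end

theorem l1_sum_hasKMw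
    (X : ℕ → Type*) [∀ m, NormedAddCommGroup (X m)] [∀ m, NormedSpace ℝ (X m)]
    [∀ m, CompleteSpace (X m)]
    (h : ∀ m, HasKMw (X m)) :
    HasKMw (lp X 1) := by
  classical
  choose M hM1 hM2 using h
  obtain ⟨e, he⟩ := exists_surjective_nat (Finset ℕ × (ℕ →₀ ℕ))
  let q : Finset ℕ → ℕ → ℕ := fun s p => 2 * p * (s.card + 1)
  have hq : ∀ s p, 0 < p → 0 < q s p := fun s p hp => by positivity
  refine ⟨fun n p => {x | (∀ m ∈ (e n).1, x m ∈ M m ((e n).2 m) (q (e n).1 p)) ∧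
    ‖tl (e n).1 x‖ ≤ 1 / (4 * p)}, fun n p hp => ?_, fun C hC p hp => ?_⟩
  · refine wpc_mono ?_ (wpc_of_parts (fun m => M m ((e n).2 m) (q (e n).1 p)) (e n).1
      (1 / (q (e n).1 p : ℕ)) (1 / (4 * p)) (fun m => hM1 m _ _ (hq _ _ hp)))
    have hp' : (0 : ℝ) < p := by exact_mod_cast hp
    simp only [q]
    push_cast
    generalize ((e n).1.card : ℕ) = c
    have hc : (0 : ℝ) ≤ c := by positivity
    have : (c : ℝ) * (1 / (2 * p * (c + 1))) ≤ 1 / (2 * p) := by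
      rw [mul_one_div, div_le_div_iff₀ (by positivity) (by positivity)]
      nlinarith
    have h2 : 2 * (1 / (4 * (p : ℝ))) = 1 / (2 * p) := by field_simp; norm_num
    have h3 : 1 / (2 * (p : ℝ)) + 1 / (2 * p) = 1 / p := by field_simp; norm_num
    linarith
  · have hp' : (0 : ℝ) < p := by exact_mod_cast hp
    obtain ⟨s, hs⟩ := tails_small C hC (ε := 1 / (4 * p)) (by positivity)
    choose k hk using fun m => hM2 m _ (proj_wpc C hC m) (q s p) (hq s p hp)
    obtain ⟨n, hn⟩ := he (s, Finsupp.onFinset s (fun m => if m ∈ s then k m else 0)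
      (fun m hm => by by_contra h; simp [h] at hm))
    refine ⟨n, fun x hx => ?_⟩
    simp only [hn, Set.mem_ofPred_eq]
    refine ⟨fun m hm => ?_, hs x hx⟩
    simp only [Finsupp.onFinset_apply, hm, if_true]
    exact hk m ⟨x, hx, rfl⟩
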